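/- arXiv:1802.06204 — 4 statements merged into one kernel-verified Lean document; each statement's English description precedes it below -/
import Mathlib

section
/- For every real number x with 0 ≤ x ≤ 1, one has e^x / (1+x)^{1+x} ≤ e^{-x²/6}. -/
theorem chernoff_u_bound (x : ℝ) (hx0 : 0 ≤ x) (hx1 : x ≤ 1) :
    Real.exp x / (1 + x) ^ (1 + x) ≤ Real.exp (-x ^ 2 / 6) := by
  have hlog : x + x ^ 2 / 6 ≤ Real.log (1 + x) * (1 + x) := by
    calc x + x ^ 2 / 6 ≤ 2 * x / (x + 2) * (1 + x) := by
          rw [div_mul_eq_mul_div, le_div_iff₀ (by positivity)]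
          nlinarith [mul_nonneg (sq_nonneg x) (by linarith : 0 ≤ 4 - x)]
      _ ≤ Real.log (1 + x) * (1 + x) := by
          gcongr
          exact Real.le_log_one_add_of_nonneg hx0
  rw [Real.rpow_def_of_pos (by positivity), ← Real.exp_sub, Real.exp_le_exp]
  linarith
end

section
/- Let a ≥ 2 and m ≥ 0 be integers, let d ≥ 1 be an integer, and let r ≥ 0 be a real number. Let p = (x₁, …, x_d) ∈ ℝ^d be a point each of whose coordinates is an integer multiple of a^{−m}. Define R(r, p, d) to be the set of all real numbers r' ≥ 0 such that r'² = r² − Σ_{i=1}^{k} (y_i − x_i)² for some integer k with 1 ≤ k ≤ d and some integers y₁, …, y_k satisfying Σ_{i=1}^{k} (y_i − x_i)² ≤ r². Then |R(r, p, d)| ≤ (r² + 1)·a^{2m}. -/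
/-- A sum of squares of differences between integers and integer multiples of `a⁻ᵐ` is a natural
multiple of `a⁻²ᵐ`. -/
theorem exists_nat_eq_sum_sq_sub_mul_pow {ι : Type*} [Fintype ι] {a : ℕ} (ha : a ≠ 0) (m : ℕ)
    (x : ι → ℝ) (hx : ∀ i, ∃ z : ℤ, x i = (z : ℝ) * (a : ℝ) ^ (-(m : ℤ))) (y : ι → ℤ) :
    ∃ N : ℕ, (∑ i, ((y i : ℝ) - x i) ^ 2) * (a : ℝ) ^ (2 * m) = N := by
  have ha' : (a : ℝ) ≠ 0 := Nat.cast_ne_zero.mpr ha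
  choose z hz using hx
  refine ⟨∑ i, (y i * (a : ℤ) ^ m - z i).natAbs ^ 2, ?_⟩
  push_cast [Nat.cast_natAbs, sq_abs]
  rw [Finset.sum_mul]
  refine Finset.sum_congr rfl fun i _ => ?_
  rw [hz i, zpow_neg, zpow_natCast]
  field_simp
  ring

theorem card_slice_radii_le (a m d : ℕ) (ha : 2 ≤ a) (hd : 1 ≤ d)
    (r : ℝ) (hr : 0 ≤ r) (p : Fin d → ℝ)
    (hp : ∀ i : Fin d, ∃ n : ℤ, p i = (n : ℝ) * (a : ℝ) ^ (-(m : ℤ))) :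
    (Set.ncard {r' : ℝ | 0 ≤ r' ∧ ∃ k : ℕ, 1 ≤ k ∧ ∃ hk : k ≤ d, ∃ y : Fin k → ℤ,
        (∑ i : Fin k, ((y i : ℝ) - p (Fin.castLE hk i)) ^ 2) ≤ r ^ 2 ∧
        r' ^ 2 = r ^ 2 - ∑ i : Fin k, ((y i : ℝ) - p (Fin.castLE hk i)) ^ 2} : ℝ)
      ≤ (r ^ 2 + 1) * (a : ℝ) ^ (2 * m) := by
  have ha1 : (1 : ℝ) ≤ a := by exact_mod_cast (by omega : 1 ≤ a)
  have hA : (1 : ℝ) ≤ (a : ℝ) ^ (2 * m) := one_le_pow₀ ha1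
  have hA0 : (0 : ℝ) < (a : ℝ) ^ (2 * m) := by linarith
  set T : Finset ℝ := (Finset.range (⌊r ^ 2 * (a : ℝ) ^ (2 * m)⌋₊ + 1)).image
    fun N : ℕ => √(r ^ 2 - N / (a : ℝ) ^ (2 * m)) with hT
  have hcard : T.card ≤ ⌊r ^ 2 * (a : ℝ) ^ (2 * m)⌋₊ + 1 :=
    Finset.card_image_le.trans_eq (Finset.card_range _)
  have hfloor : (⌊r ^ 2 * (a : ℝ) ^ (2 * m)⌋₊ : ℝ) ≤ r ^ 2 * (a : ℝ) ^ (2 * m) :=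
    Nat.floor_le (by positivity)
  calc _ ≤ ((T : Set ℝ).ncard : ℝ) := by
        refine Nat.cast_le.mpr (Set.ncard_le_ncard ?_ T.finite_toSet)
        rintro r' ⟨hr', k, -, hk, y, hle, heq⟩
        obtain ⟨N, hN⟩ := exists_nat_eq_sum_sq_sub_mul_pow (by omega : a ≠ 0) m
          (fun i => p (Fin.castLE hk i)) (fun i => hp _) y
        rw [Finset.mem_coe, hT, Finset.mem_image]
        refine ⟨N, Finset.mem_range_succ_iff.mpr (Nat.le_floor ?_), ?_⟩
        · rw [← hN]
          gcongr
        · rw [← hN, mul_div_cancel_right₀ _ hA0.ne', ← heq, Real.sqrt_sq hr']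
    _ = (T.card : ℝ) := by rw [Set.ncard_coe_finset]
    _ ≤ (⌊r ^ 2 * (a : ℝ) ^ (2 * m)⌋₊ + 1 : ℝ) := by exact_mod_cast hcard
    _ ≤ (r ^ 2 + 1) * (a : ℝ) ^ (2 * m) := by linarith
end

section
/- Let β ∈ (0,1) be a real number, d ≥ 1 an integer, p ∈ ℝ^d an arbitrary point, and r a real number with r > 2·d^{3/2}/β. Let C(r, p, d) be the number of lattice points z ∈ ℤ^d with ‖z − p‖ ≤ r, and let V_d(r) = π^{d/2} r^d / Γ(d/2 + 1). Then (1 − β)·C(r, p, d) ≤ V_d(r) ≤ (1 + β)·C(r, p, d). -/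
open MeasureTheory Metric

/-- The half-open unit cube of `ℝ^d` centred at the lattice point `z`. -/
def latticeCube {d : ℕ} (z : Fin d → ℤ) : Set (Fin d → ℝ) :=
  Set.univ.pi fun i => Set.Ico ((z i : ℝ) - 1 / 2) (z i + 1 / 2)

theorem measurableSet_latticeCube {d : ℕ} (z : Fin d → ℤ) : MeasurableSet (latticeCube z) :=
  MeasurableSet.univ_pi fun _ => measurableSet_Ico

theorem volume_latticeCube {d : ℕ} (z : Fin d → ℤ) : volume (latticeCube z) = 1 := by
  rw [latticeCube, volume_pi_pi]
  refine Finset.prod_eq_one fun i _ => ?_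
  rw [Real.volume_Ico]
  ring_nf
  simp

theorem mem_latticeCube_iff {d : ℕ} {z : Fin d → ℤ} {x : Fin d → ℝ} :
    x ∈ latticeCube z ↔ (fun i => ⌊x i + 1 / 2⌋) = z := by
  simp only [latticeCube, Set.mem_univ_pi, Set.mem_Ico, funext_iff, Int.floor_eq_iff]
  refine forall_congr' fun i => ?_
  constructor <;> rintro ⟨h₁, h₂⟩ <;> constructor <;> linarith

theorem pairwise_disjoint_latticeCube (d : ℕ) :
    Pairwise (Function.onFun Disjoint (latticeCube (d := d))) := by
  intro z w hzw
  refine Set.disjoint_left.2 fun x hz hw => hzw ?_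
  rw [← mem_latticeCube_iff.1 hz, mem_latticeCube_iff.1 hw]

theorem volume_biUnion_latticeCube {d : ℕ} (S : Set (Fin d → ℤ)) :
    volume (⋃ z ∈ S, latticeCube z) = S.encard := by
  rw [measure_biUnion S.to_countable ((pairwise_disjoint_latticeCube d).set_pairwise S)
    fun z _ => measurableSet_latticeCube z]
  simp only [volume_latticeCube]
  exact ENNReal.tsum_set_one S

theorem dist_le_of_mem_latticeCube {d : ℕ} {z : Fin d → ℤ} {x : Fin d → ℝ}
    (hx : x ∈ latticeCube z) :
    dist (WithLp.toLp 2 x) (WithLp.toLp 2 fun i => (z i : ℝ)) ≤ √d / 2 := by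
  rw [EuclideanSpace.dist_eq]
  refine Real.sqrt_le_iff.2 ⟨by positivity, ?_⟩
  have h : ∀ i, dist (x i) (z i : ℝ) ^ 2 ≤ 1 / 4 := fun i => by
    obtain ⟨h₁, h₂⟩ := hx i (Set.mem_univ i)
    rw [Real.dist_eq, sq_abs]
    nlinarith
  calc ∑ i, dist (x i) (z i : ℝ) ^ 2 ≤ ∑ _i : Fin d, (1 / 4 : ℝ) :=
        Finset.sum_le_sum fun i _ => h i
    _ = (√d / 2) ^ 2 := by
        rw [div_pow, Real.sq_sqrt (Nat.cast_nonneg d)]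
        simp
        ring

theorem sum_sq_le_iff_dist_le {d : ℕ} (x p : Fin d → ℝ) {r : ℝ} (hr : 0 ≤ r) :
    ∑ i, (x i - p i) ^ 2 ≤ r ^ 2 ↔ dist (WithLp.toLp 2 x) (WithLp.toLp 2 p) ≤ r := by
  rw [EuclideanSpace.dist_eq, Real.sqrt_le_left hr]
  simp only [Real.dist_eq, sq_abs]

theorem volume_toLp_preimage_closedBall {d : ℕ} (hd : 1 ≤ d) (p : EuclideanSpace ℝ (Fin d))
    {r : ℝ} (hr : 0 ≤ r) :
    volume (WithLp.toLp 2 ⁻¹' closedBall p r : Set (Fin d → ℝ)) =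
      ENNReal.ofReal (Real.pi ^ ((d : ℝ) / 2) * r ^ d / Real.Gamma ((d : ℝ) / 2 + 1)) := by
  have : Nonempty (Fin d) := ⟨⟨0, hd⟩⟩
  rw [(PiLp.volume_preserving_toLp (Fin d)).measure_preimage
    measurableSet_closedBall.nullMeasurableSet, EuclideanSpace.volume_closedBall,
    Fintype.card_fin, ← ENNReal.ofReal_pow hr, ← ENNReal.ofReal_mul (by positivity)]
  congr 1
  have h : √Real.pi ^ d = Real.pi ^ ((d : ℝ) / 2) := by
    rw [Real.sqrt_eq_rpow, ← Real.rpow_natCast, ← Real.rpow_mul Real.pi_pos.le]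
    ring_nf
  rw [h]
  ring

/-- Comparison of the number of lattice points in a ball of radius `r` with the volumes of the
concentric balls of radii `r ± √d / 2`. -/
theorem volume_le_ncard_and_ncard_le_volume {d : ℕ} (hd : 1 ≤ d) (p : Fin d → ℝ) {r : ℝ}
    (hr : √d / 2 ≤ r) :
    Real.pi ^ ((d : ℝ) / 2) * (r - √d / 2) ^ d / Real.Gamma ((d : ℝ) / 2 + 1)
        ≤ (Set.ncard {z : Fin d → ℤ | ∑ i : Fin d, ((z i : ℝ) - p i) ^ 2 ≤ r ^ 2} : ℝ) ∧
      (Set.ncard {z : Fin d → ℤ | ∑ i : Fin d, ((z i : ℝ) - p i) ^ 2 ≤ r ^ 2} : ℝ)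
        ≤ Real.pi ^ ((d : ℝ) / 2) * (r + √d / 2) ^ d / Real.Gamma ((d : ℝ) / 2 + 1) := by
  have hs : 0 ≤ √(d : ℝ) / 2 := by positivity
  have hr0 : 0 ≤ r := hs.trans hr
  set S := {z : Fin d → ℤ | ∑ i : Fin d, ((z i : ℝ) - p i) ^ 2 ≤ r ^ 2}
  have hmem : ∀ z, z ∈ S ↔ dist (WithLp.toLp 2 fun i => (z i : ℝ)) (WithLp.toLp 2 p) ≤ r :=
    fun z => sum_sq_le_iff_dist_le _ p hr0
  have hupper : (S.encard : ENNReal) ≤ ENNReal.ofReal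
      (Real.pi ^ ((d : ℝ) / 2) * (r + √d / 2) ^ d / Real.Gamma ((d : ℝ) / 2 + 1)) := by
    rw [← volume_biUnion_latticeCube,
      ← volume_toLp_preimage_closedBall hd (WithLp.toLp 2 p) (by positivity)]
    refine measure_mono (Set.iUnion₂_subset fun z hz x hx => ?_)
    rw [Set.mem_preimage, mem_closedBall]
    have := dist_triangle (WithLp.toLp 2 x) (WithLp.toLp 2 fun i => (z i : ℝ)) (WithLp.toLp 2 p)
    linarith [(hmem z).1 hz, dist_le_of_mem_latticeCube hx]
  have hlower : ENNReal.ofReal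
      (Real.pi ^ ((d : ℝ) / 2) * (r - √d / 2) ^ d / Real.Gamma ((d : ℝ) / 2 + 1)) ≤
        (S.encard : ENNReal) := by
    rw [← volume_biUnion_latticeCube,
      ← volume_toLp_preimage_closedBall hd (WithLp.toLp 2 p) (sub_nonneg.2 hr)]
    refine measure_mono fun x hx => ?_
    rw [Set.mem_preimage, mem_closedBall] at hx
    have hxz : x ∈ latticeCube fun i => ⌊x i + 1 / 2⌋ := mem_latticeCube_iff.2 rfl
    refine Set.mem_biUnion ((hmem _).2 ?_) hxz
    have h₁ := dist_le_of_mem_latticeCube hxz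
    rw [dist_comm] at h₁
    linarith [dist_triangle (WithLp.toLp 2 fun i => ((⌊x i + 1 / 2⌋ : ℤ) : ℝ))
      (WithLp.toLp 2 x) (WithLp.toLp 2 p)]
  have hfin : S.Finite := by
    rw [← Set.encard_ne_top_iff]
    intro h
    rw [h] at hupper
    simp at hupper
  rw [← hfin.cast_ncard_eq] at hupper hlower
  simp only [ENat.toENNReal_coe] at hupper hlower
  rw [← ENNReal.ofReal_natCast] at hupper hlower
  exact ⟨(ENNReal.ofReal_le_ofReal_iff (Nat.cast_nonneg _)).1 hlower,
    (ENNReal.ofReal_le_ofReal_iff (by positivity)).1 hupper⟩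

theorem one_sub_mul_one_add_pow_le_one {β h : ℝ} {d : ℕ}
    (h0 : 0 ≤ h) (hh : d * h ≤ β) : (1 - β) * (1 + h) ^ d ≤ 1 := by
  calc (1 - β) * (1 + h) ^ d ≤ Real.exp (-β) * Real.exp h ^ d := by
        gcongr
        · linarith [Real.add_one_le_exp (-β)]
        · linarith [Real.add_one_le_exp h]
    _ = Real.exp (d * h - β) := by rw [← Real.exp_nat_mul, ← Real.exp_add]; ring_nf
    _ ≤ 1 := Real.exp_le_one_iff.2 (by linarith)

theorem one_le_one_add_mul_one_sub_pow {β h : ℝ} {d : ℕ} (hβ0 : 0 ≤ β) (hβ1 : β ≤ 1)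
    (h1 : h ≤ 1) (hh : 4 * (d * h) ≤ β) : 1 ≤ (1 + β) * (1 - h) ^ d := by
  have hb := one_add_mul_le_pow (show (-2 : ℝ) ≤ -h by linarith) d
  rw [← sub_eq_add_neg] at hb
  calc (1 : ℝ) ≤ (1 + β) * (1 - β / 4) := by nlinarith
    _ ≤ (1 + β) * (1 - h) ^ d := by gcongr; linarith

theorem volume_approximates_lattice_count (β : ℝ) (hβ0 : 0 < β) (hβ1 : β < 1)
    (d : ℕ) (hd : 1 ≤ d) (p : Fin d → ℝ) (r : ℝ)
    (hr : 2 * (d : ℝ) ^ ((3 : ℝ) / 2) / β < r) :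
    (1 - β) * (Set.ncard {z : Fin d → ℤ | ∑ i : Fin d, ((z i : ℝ) - p i) ^ 2 ≤ r ^ 2} : ℝ)
        ≤ Real.pi ^ ((d : ℝ) / 2) * r ^ d / Real.Gamma ((d : ℝ) / 2 + 1) ∧
      Real.pi ^ ((d : ℝ) / 2) * r ^ d / Real.Gamma ((d : ℝ) / 2 + 1)
        ≤ (1 + β) *
          (Set.ncard {z : Fin d → ℤ | ∑ i : Fin d, ((z i : ℝ) - p i) ^ 2 ≤ r ^ 2} : ℝ) := by
  have hd1 : (1 : ℝ) ≤ d := by exact_mod_cast hd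
  have hd0 : (0 : ℝ) < d := by linarith
  have hr0 : 0 < r := lt_trans (by positivity) hr
  have hpow : (d : ℝ) ^ ((3 : ℝ) / 2) = d * √d := by
    rw [Real.sqrt_eq_rpow, show (3 : ℝ) / 2 = 1 + 1 / 2 by norm_num, Real.rpow_add hd0,
      Real.rpow_one]
  rw [hpow, div_lt_iff₀ hβ0] at hr
  obtain ⟨h, hh⟩ : ∃ h, h = √(d : ℝ) / 2 / r := ⟨_, rfl⟩
  have hs : √(d : ℝ) / 2 = r * h := by rw [hh]; field_simp
  have h0 : 0 ≤ h := by rw [hh]; positivity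
  have hdh : 4 * (d * h) ≤ β := by
    refine le_of_mul_le_mul_left ?_ hr0
    linear_combination hr.le + (-4 * d) * hs
  have h1 : h ≤ 1 := by nlinarith
  obtain ⟨hlow, hup⟩ := volume_le_ncard_and_ncard_le_volume hd p (r := r) (by nlinarith)
  rw [hs, show r - r * h = r * (1 - h) by ring, mul_pow] at hlow
  rw [hs, show r + r * h = r * (1 + h) by ring, mul_pow] at hup
  set V := Real.pi ^ ((d : ℝ) / 2) * r ^ d / Real.Gamma ((d : ℝ) / 2 + 1) with hV
  have hV0 : 0 ≤ V := by positivity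
  constructor
  · calc _ ≤ (1 - β) * (Real.pi ^ ((d : ℝ) / 2) * (r ^ d * (1 + h) ^ d) /
          Real.Gamma ((d : ℝ) / 2 + 1)) := mul_le_mul_of_nonneg_left hup (by linarith)
      _ = V * ((1 - β) * (1 + h) ^ d) := by rw [hV]; ring
      _ ≤ V := mul_le_of_le_one_right hV0
          (one_sub_mul_one_add_pow_le_one h0 (by nlinarith))
  · calc V ≤ V * ((1 + β) * (1 - h) ^ d) := le_mul_of_one_le_right hV0
          (one_le_one_add_mul_one_sub_pow hβ0.le hβ1.le h1 hdh)
      _ = (1 + β) * (Real.pi ^ ((d : ℝ) / 2) * (r ^ d * (1 - h) ^ d) /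
          Real.Gamma ((d : ℝ) / 2 + 1)) := by rw [hV]; ring
      _ ≤ _ := mul_le_mul_of_nonneg_left hlow (by linarith)
end

section
/- Let k ≥ 2 be an even integer, n ≥ 3 an integer, and δ = 3/10. Define D = (d₁, …, d_n) ∈ ℝ^n by d₁ = d₂ = d₃ = 1 − δ and d_i = 1/2 for 4 ≤ i ≤ n, and let r_C be the positive real number with r_C^k = 2(1−δ)^k + δ^k + (n−3)·(1/2)^k. Then for every lattice point Y = (y₁, …, y_n) ∈ ℤ^n: Σ_{i=1}^{n} (y_i − d_i)^k ≤ r_C^k if and only if every y_i ∈ {0,1} and at least one of y₁, y₂, y₃ equals 1. -/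
theorem mul_pow_lt_pow_of_mul_sq_lt_sq {a b c : ℝ} {k : ℕ} (ha : 0 < a) (hab : a ≤ b)
    (h : c * a ^ 2 < b ^ 2) (hk : 2 ≤ k) : c * a ^ k < b ^ k := by
  obtain ⟨j, rfl⟩ := Nat.exists_eq_add_of_le hk
  calc c * a ^ (2 + j) = c * a ^ 2 * a ^ j := by ring
    _ < b ^ 2 * a ^ j := mul_lt_mul_of_pos_right h (pow_pos ha j)
    _ ≤ b ^ 2 * b ^ j := by gcongr
    _ = b ^ (2 + j) := by ring

theorem Even.pow_le_pow_of_le_abs {k : ℕ} (hk : Even k) {a x : ℝ} (ha : 0 ≤ a) (h : a ≤ |x|) :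
    a ^ k ≤ x ^ k := by
  rw [← hk.pow_abs x]
  exact pow_le_pow_left₀ ha h k

theorem sub_seven_tenths_pow_cases {k : ℕ} (hk : Even k) (y : ℤ) :
    (y = 1 ∧ ((y : ℝ) - 7 / 10) ^ k = (3 / 10) ^ k) ∨
    (y = 0 ∧ ((y : ℝ) - 7 / 10) ^ k = (7 / 10) ^ k) ∨
    (y ≠ 0 ∧ y ≠ 1 ∧ (13 / 10 : ℝ) ^ k ≤ ((y : ℝ) - 7 / 10) ^ k) := by
  have h : y = 1 ∨ y = 0 ∨ 2 ≤ y ∨ y ≤ -1 := by omega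
  rcases h with rfl | rfl | h | h
  · left; norm_num
  · right; left
    simp [hk.neg_pow]
  all_goals
    refine Or.inr (Or.inr ⟨by omega, by omega, hk.pow_le_pow_of_le_abs (by norm_num) ?_⟩)
    rw [le_abs]
    rify at h
  · left; linarith
  · right; linarith

theorem sub_half_pow_cases {k : ℕ} (hk : Even k) (y : ℤ) :
    ((y = 0 ∨ y = 1) ∧ ((y : ℝ) - 1 / 2) ^ k = (1 / 2) ^ k) ∨
    (¬ (y = 0 ∨ y = 1) ∧ (3 / 2 : ℝ) ^ k ≤ ((y : ℝ) - 1 / 2) ^ k) := by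
  have h : y = 1 ∨ y = 0 ∨ 2 ≤ y ∨ y ≤ -1 := by omega
  rcases h with rfl | rfl | h | h
  · left; norm_num
  · left
    simp [hk.neg_pow]
  all_goals
    refine Or.inr ⟨by omega, hk.pow_le_pow_of_le_abs (by norm_num) ?_⟩
    rw [le_abs]
    rify at h
  · left; linarith
  · right; linarith

theorem clause_gadget_ball (k n : ℕ) (hk : 2 ≤ k) (hke : Even k) (hn : 3 ≤ n)
    (D : Fin n → ℝ) (hD : ∀ i : Fin n, D i = if (i : ℕ) < 3 then 1 - (3 / 10 : ℝ) else 1 / 2)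
    (y : Fin n → ℤ) :
    (∑ i : Fin n, ((y i : ℝ) - D i) ^ k
        ≤ 2 * (1 - (3 / 10 : ℝ)) ^ k + (3 / 10 : ℝ) ^ k + ((n : ℝ) - 3) * (1 / 2 : ℝ) ^ k)
      ↔ ((∀ i : Fin n, y i = 0 ∨ y i = 1) ∧
          (y ⟨0, by omega⟩ = 1 ∨ y ⟨1, by omega⟩ = 1 ∨ y ⟨2, by omega⟩ = 1)) := by
  obtain ⟨m, rfl⟩ := Nat.exists_eq_add_of_le' hn
  have hsum : ∑ i : Fin (m + 3), ((y i : ℝ) - D i) ^ k =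
      ((y ⟨0, by omega⟩ : ℝ) - 7 / 10) ^ k + ((y ⟨1, by omega⟩ : ℝ) - 7 / 10) ^ k +
        ((y ⟨2, by omega⟩ : ℝ) - 7 / 10) ^ k +
        ∑ i : Fin m, ((y i.succ.succ.succ : ℝ) - 1 / 2) ^ k := by
    have h0 : D 0 = 7 / 10 := by rw [hD]; norm_num
    have h1 : D (Fin.succ 0) = 7 / 10 := by rw [hD]; norm_num
    have h2 : D (Fin.succ (Fin.succ 0)) = 7 / 10 := by
      rw [hD, if_pos (by simp only [Fin.val_succ, Fin.val_zero]; omega)]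
      norm_num
    have h3 (i : Fin m) : D i.succ.succ.succ = 1 / 2 := by
      rw [hD, if_neg]
      simp only [Fin.val_succ]
      omega
    simp only [Fin.sum_univ_succ, h0, h1, h2, h3, ← add_assoc]
    rfl
  have hforall : (∀ i : Fin (m + 3), y i = 0 ∨ y i = 1) ↔
      (y ⟨0, by omega⟩ = 0 ∨ y ⟨0, by omega⟩ = 1) ∧ (y ⟨1, by omega⟩ = 0 ∨ y ⟨1, by omega⟩ = 1) ∧
        (y ⟨2, by omega⟩ = 0 ∨ y ⟨2, by omega⟩ = 1) ∧
        ∀ i : Fin m, y i.succ.succ.succ = 0 ∨ y i.succ.succ.succ = 1 := by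
    simp only [Fin.forall_fin_succ (n := m + 2), Fin.forall_fin_succ (n := m + 1),
      Fin.forall_fin_succ (n := m)]
    rfl
  rw [hsum, hforall]
  have hB : (0 : ℝ) < (3 / 10) ^ k := by positivity
  have hC : (0 : ℝ) < (1 / 2) ^ k := by positivity
  have hBA : (3 / 10 : ℝ) ^ k < (7 / 10) ^ k :=
    pow_lt_pow_left₀ (by norm_num) (by norm_num) (by omega)
  have hCA : (1 / 2 : ℝ) ^ k < (7 / 10) ^ k :=
    pow_lt_pow_left₀ (by norm_num) (by norm_num) (by omega)
  have hAE : 2 * (7 / 10 : ℝ) ^ k < (13 / 10) ^ k :=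
    mul_pow_lt_pow_of_mul_sq_lt_sq (by norm_num) (by norm_num) (by norm_num) hk
  have hAF : 3 * (7 / 10 : ℝ) ^ k < (3 / 2) ^ k :=
    mul_pow_lt_pow_of_mul_sq_lt_sq (by norm_num) (by norm_num) (by norm_num) hk
  have hδ : (1 - 3 / 10 : ℝ) = 7 / 10 := by norm_num
  have hm : ((m + 3 : ℕ) : ℝ) - 3 = m := by push_cast; ring
  rw [hδ, hm]
  by_cases hz : ∀ i : Fin m, y i.succ.succ.succ = 0 ∨ y i.succ.succ.succ = 1
  · have hS : ∑ i : Fin m, ((y i.succ.succ.succ : ℝ) - 1 / 2) ^ k = m * (1 / 2 : ℝ) ^ k := by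
      rw [Finset.sum_congr rfl fun i _ ↦
        ((sub_half_pow_cases hke _).resolve_right fun h ↦ h.1 (hz i)).2]
      simp
    rw [hS]
    simp only [hz, implies_true, and_true]
    rcases sub_seven_tenths_pow_cases hke (y ⟨0, by omega⟩) with ⟨a, a'⟩ | ⟨a, a'⟩ | ⟨a, b, a'⟩ <;>
    rcases sub_seven_tenths_pow_cases hke (y ⟨1, by omega⟩) with ⟨c, c'⟩ | ⟨c, c'⟩ | ⟨c, d, c'⟩ <;>
    rcases sub_seven_tenths_pow_cases hke (y ⟨2, by omega⟩) with ⟨e, e'⟩ | ⟨e, e'⟩ | ⟨e, f, e'⟩ <;>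
    first
      | exact iff_of_true (by linarith) (by omega)
      | exact iff_of_false (by intro h; linarith) (by omega)
  · refine iff_of_false ?_ (fun h ↦ hz h.1.2.2.2)
    push Not at hz
    obtain ⟨j, hj⟩ := hz
    have hj' := ((sub_half_pow_cases hke (y j.succ.succ.succ)).resolve_left
      fun h ↦ by omega).2
    have hS : ((y j.succ.succ.succ : ℝ) - 1 / 2) ^ k - (1 / 2) ^ k ≤
        ∑ i : Fin m, (((y i.succ.succ.succ : ℝ) - 1 / 2) ^ k - (1 / 2 : ℝ) ^ k) := by
      refine Finset.single_le_sum (f := fun i : Fin m ↦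
        ((y i.succ.succ.succ : ℝ) - 1 / 2) ^ k - (1 / 2 : ℝ) ^ k) (fun i _ ↦ ?_)
        (Finset.mem_univ j)
      rcases sub_half_pow_cases hke (y i.succ.succ.succ) with h | h <;> linarith [h.2]
    rw [Finset.sum_sub_distrib] at hS
    simp only [Finset.sum_const, Finset.card_univ, Fintype.card_fin, nsmul_eq_mul] at hS
    have hlow (z : ℤ) : (3 / 10 : ℝ) ^ k ≤ ((z : ℝ) - 7 / 10) ^ k := by
      rcases sub_seven_tenths_pow_cases hke z with h | h | h
      · exact h.2.ge
      · linarith [h.2]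
      · linarith [h.2.2]
    linarith [hlow (y ⟨0, by omega⟩), hlow (y ⟨1, by omega⟩), hlow (y ⟨2, by omega⟩)]
end
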